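/- Let L ∈ ℕ, ν a positive integer, and s ∈ {0,1,…,ν−1}. Then the polynomial F(L,ν,s,q) = ∑_{j∈ℤ} (−1)^j q^{(ν+1)(2ν+1)j^2 + (ν+1)(2s+1)j} [2L+1 choose L−s−(2ν+1)j]_q has nonnegative coefficients. -/

import Mathlib

open LaurentPolynomial Finset

noncomputable section

/-- The Gaussian binomial coefficient `[m choose n]_q` as a polynomial in `q`,
defined via the `q`-Pascal recurrence; it equals `(q;q)_m/((q;q)_n (q;q)_{m-n})`
for `0 ≤ n ≤ m`. -/
def gb : ℕ → ℕ → Polynomial ℤ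
  | _, 0 => 1
  | 0, _ + 1 => 0
  | m + 1, n + 1 => gb m n + Polynomial.X ^ (n + 1) * gb m (n + 1)

/-- `[m choose n]_q` with integer indices, zero unless `0 ≤ n ≤ m`,
viewed as a Laurent polynomial in `q`. -/
def qbin (m n : ℤ) : LaurentPolynomial ℤ :=
  if 0 ≤ n ∧ n ≤ m then (gb m.toNat n.toNat).toLaurent else 0

/-- A Laurent polynomial is a polynomial in `q` with nonnegative coefficients. -/
def IsNonneg (x : LaurentPolynomial ℤ) : Prop :=
  ∃ P : Polynomial ℤ, (∀ n, 0 ≤ P.coeff n) ∧ P.toLaurent = x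

/-- The triangular number `T(j) = j(j+1)/2`. -/
def tri (j : ℤ) : ℤ := j * (j + 1) / 2


theorem gb_eq_zero_of_lt : ∀ {m n : ℕ}, m < n → gb m n = 0
  | _, 0, h => absurd h (Nat.not_lt_zero _)
  | 0, n + 1, _ => by simp [gb]
  | m + 1, n + 1, h => by
    rw [gb, gb_eq_zero_of_lt (by omega : m < n), gb_eq_zero_of_lt (by omega : m < n + 1)]
    simp

theorem gb_coeff_nonneg (m n k : ℕ) : 0 ≤ (gb m n).coeff k := by
  induction m generalizing n k with
  | zero =>
    cases n with
    | zero =>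
      rw [gb, Polynomial.coeff_one]
      split_ifs <;> norm_num
    | succ n => simp [gb]
  | succ m ih =>
    cases n with
    | zero =>
      rw [gb, Polynomial.coeff_one]
      split_ifs <;> norm_num
    | succ n =>
      rw [gb, Polynomial.coeff_add, Polynomial.coeff_X_pow_mul']
      refine add_nonneg (ih _ _) ?_
      split_ifs
      · exact ih _ _
      · exact le_rfl

theorem qbin_natCast (m n : ℕ) : qbin m n = (gb m n).toLaurent := by
  unfold qbin
  split_ifs with h
  · simp
  · rw [gb_eq_zero_of_lt (by omega), map_zero]

theorem qbin_eq_zero {m n : ℤ} (h : n < 0 ∨ m < n) : qbin m n = 0 :=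
  if_neg (by omega)

theorem qbin_zero_right {m : ℤ} (hm : 0 ≤ m) : qbin m 0 = 1 := by
  obtain ⟨m, rfl⟩ := Int.eq_ofNat_of_zero_le hm
  have h := qbin_natCast m 0
  rw [Nat.cast_zero] at h
  rw [h]
  cases m <;> simp [gb]

/-- The `q`-Pascal recurrence. -/
theorem qbin_pascal {m : ℤ} (hm : 0 ≤ m) (n : ℤ) :
    qbin (m + 1) n = qbin m (n - 1) + T n * qbin m n := by
  rcases lt_trichotomy n 0 with hn | rfl | hn
  · simp [qbin_eq_zero (Or.inl hn), qbin_eq_zero (Or.inl (by omega : n - 1 < 0))]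
  · rw [qbin_zero_right hm, qbin_zero_right (by omega), qbin_eq_zero (Or.inl (by omega)), T_zero]
    simp
  · obtain ⟨m, rfl⟩ := Int.eq_ofNat_of_zero_le hm
    obtain ⟨n, rfl⟩ : ∃ k : ℕ, n = ((k + 1 : ℕ) : ℤ) := ⟨(n - 1).toNat, by omega⟩
    have h₁ : ((m : ℕ) : ℤ) + 1 = ((m + 1 : ℕ) : ℤ) := by push_cast; ring
    have h₂ : ((n + 1 : ℕ) : ℤ) - 1 = (n : ℤ) := by push_cast; ring
    rw [h₂, h₁, qbin_natCast, qbin_natCast, qbin_natCast, gb, map_add, map_mul,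
      Polynomial.toLaurent_X_pow]

theorem qbin_zero_left_ne {n : ℤ} (hn : n ≠ 0) : qbin 0 n = 0 :=
  qbin_eq_zero (by omega)

/-- The second form of the `q`-Pascal recurrence. -/
theorem qbin_pascal' {m : ℤ} (hm : 0 ≤ m) (n : ℤ) :
    qbin (m + 1) n = qbin m n + T (m + 1 - n) * qbin m (n - 1) := by
  induction m, hm using Int.leInduction generalizing n with
  | base =>
    rw [qbin_pascal le_rfl]
    by_cases h0 : n = 0
    · subst h0
      rw [qbin_zero_left_ne (by norm_num : (0 : ℤ) - 1 ≠ 0), T_zero]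
      simp
    by_cases h1 : n = 1
    · subst h1
      simp [qbin_zero_left_ne one_ne_zero]
    · rw [qbin_zero_left_ne h0, qbin_zero_left_ne (by omega)]
      simp
  | succ m hm ih =>
    rw [qbin_pascal (by omega)]
    have h₁ := ih n
    have h₂ := ih (n - 1)
    have h₃ := qbin_pascal hm n
    have h₄ := qbin_pascal hm (n - 1)
    have e₁ : (T n : LaurentPolynomial ℤ) * T (m + 1 - n) = T (m + 1) := by
      rw [← T_add]; congr 1; ring
    have e₂ : (T (m + 1 + 1 - n) : LaurentPolynomial ℤ) * T (n - 1) = T (m + 1) := by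
      rw [← T_add]; congr 1; ring
    have e₃ : m + 1 - (n - 1) = m + 1 + 1 - n := by ring
    rw [e₃] at h₂
    linear_combination h₂ + T n * h₁ - h₃ - T (m + 1 + 1 - n) * h₄
      + qbin m (n - 1) * e₁ - qbin m (n - 1) * e₂

theorem qbin_symm (m n : ℤ) : qbin m (m - n) = qbin m n := by
  rcases lt_or_ge m 0 with hm | hm
  · rw [qbin_eq_zero (by omega), qbin_eq_zero (by omega)]
  induction m, hm using Int.leInduction generalizing n with
  | base =>
    by_cases h0 : n = 0
    · simp [h0]
    · rw [qbin_zero_left_ne (by omega), qbin_zero_left_ne h0]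
  | succ m hm ih =>
    rw [qbin_pascal hm, qbin_pascal' hm, show m + 1 - n - 1 = m - n by ring,
      show m + 1 - n = m - (n - 1) by ring, ih, ih]

theorem qbin_absorb (m n : ℤ) :
    (1 - T n) * qbin m n = (1 - T m) * qbin (m - 1) (n - 1) := by
  rcases lt_trichotomy m 0 with hm | rfl | hm
  · rw [qbin_eq_zero (by omega), qbin_eq_zero (by omega)]; simp
  · by_cases h0 : n = 0
    · simp [h0, T_zero]
    · rw [qbin_zero_left_ne h0, T_zero]; simp
  · have h₁ := qbin_pascal (by omega : 0 ≤ m - 1) n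
    have h₂ := qbin_pascal' (by omega : 0 ≤ m - 1) n
    rw [sub_add_cancel] at h₁ h₂
    have e : (T n : LaurentPolynomial ℤ) * T (m - n) = T m := by
      rw [← T_add]; congr 1; ring
    linear_combination h₁ - T n * h₂ - qbin (m - 1) (n - 1) * e

theorem qbin_absorb' (m n : ℤ) :
    (1 - T (m - n)) * qbin m n = (1 - T m) * qbin (m - 1) n := by
  rw [← qbin_symm m n, qbin_absorb m (m - n), ← qbin_symm (m - 1) n]
  congr 2; ring

theorem qbin_absorb_lower (m n : ℤ) :
    (1 - T n) * qbin m n = (1 - T (m - n + 1)) * qbin m (n - 1) := by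
  rw [qbin_absorb, ← qbin_absorb', show m - (n - 1) = m - n + 1 by ring]

theorem tri_succ (n : ℤ) : tri (n + 1) = tri n + n + 1 := by
  unfold tri
  rw [show (n + 1) * (n + 1 + 1) = n * (n + 1) + (n + 1) * 2 by ring,
    Int.add_mul_ediv_right _ _ (by norm_num)]
  ring

theorem two_mul_tri (n : ℤ) : 2 * tri n = n * (n + 1) :=
  Int.mul_ediv_cancel' (Int.even_mul_succ_self n).two_dvd

/-- The coefficient `q^{T(m)+T(n)} [N choose n]_q [n choose m]_q`. -/
def trinomialCoeff (N m n : ℤ) : LaurentPolynomial ℤ :=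
  T (tri m + tri n) * qbin N n * qbin n m

theorem trinomialCoeff_eq_zero {N m n : ℤ} (h : ¬(m ∈ Icc 0 N ∧ n ∈ Icc 0 N)) :
    trinomialCoeff N m n = 0 := by
  rw [trinomialCoeff]
  simp only [Finset.mem_Icc] at h
  by_cases hn : 0 ≤ n ∧ n ≤ N
  · rw [qbin_eq_zero (m := n) (n := m) (by omega), mul_zero]
  · rw [qbin_eq_zero (m := N) (n := n) (by omega), mul_zero, zero_mul]

theorem trinomialCoeff_succ {N : ℤ} (hN : 0 ≤ N) (m n : ℤ) :
    trinomialCoeff (N + 1) m n = trinomialCoeff N m n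
      + T (N + 1) * trinomialCoeff N m (n - 1)
      + T (N + 1 + n) * trinomialCoeff N (m - 1) (n - 1) := by
  unfold trinomialCoeff
  rw [qbin_pascal' hN n]
  have key : qbin N (n - 1) * qbin n m
      = qbin N (n - 1) * (qbin (n - 1) m + T (n - m) * qbin (n - 1) (m - 1)) := by
    rcases le_or_gt n 0 with hn | hn
    · rw [qbin_eq_zero (m := N) (n := n - 1) (by omega)]; simp
    · have h := qbin_pascal' (by omega : 0 ≤ n - 1) m
      rw [sub_add_cancel] at h
      rw [h]
  have t₁ := tri_succ (n - 1)
  have t₂ := tri_succ (m - 1)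
  rw [sub_add_cancel] at t₁ t₂
  have e₁ : (T (tri m + tri n) : LaurentPolynomial ℤ) * T (N + 1 - n)
      = T (N + 1) * T (tri m + tri (n - 1)) := by
    rw [← T_add, ← T_add]; congr 1; omega
  have e₂ : (T (N + 1) : LaurentPolynomial ℤ) * T (tri m + tri (n - 1)) * T (n - m)
      = T (N + 1 + n) * T (tri (m - 1) + tri (n - 1)) := by
    rw [← T_add, ← T_add, ← T_add]; congr 1; omega
  linear_combination T (tri m + tri n) * T (N + 1 - n) * key
    + (qbin N (n - 1) * (qbin (n - 1) m + T (n - m) * qbin (n - 1) (m - 1))) * e₁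
    + qbin N (n - 1) * qbin (n - 1) (m - 1) * e₂

theorem one_sub_mul_trinomialCoeff (N m n : ℤ) :
    (1 - T (n - m)) * trinomialCoeff N m n
      = (T n - T (N + 1)) * trinomialCoeff N m (n - 1) := by
  unfold trinomialCoeff
  have h₁ := qbin_absorb' n m
  have h₂ := qbin_absorb_lower N n
  have t₁ := tri_succ (n - 1)
  rw [sub_add_cancel] at t₁
  have e₁ : (T (tri m + tri n) : LaurentPolynomial ℤ) = T n * T (tri m + tri (n - 1)) := by
    rw [← T_add]; congr 1; omega
  have e₂ : (T n : LaurentPolynomial ℤ) * T (N - n + 1) = T (N + 1) := by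
    rw [← T_add]; congr 1; omega
  rw [e₁]
  linear_combination T n * T (tri m + tri (n - 1)) * qbin N n * h₁
    + T n * T (tri m + tri (n - 1)) * qbin (n - 1) m * h₂
    - T (tri m + tri (n - 1)) * qbin (n - 1) m * qbin N (n - 1) * e₂

/-- The linear functional `g ↦ ∑_{m,n} q^{T(m)+T(n)} [N choose n]_q [n choose m]_q g(m, n)`. -/
def trinomialSum (N : ℤ) (g : ℤ → ℤ → LaurentPolynomial ℤ) : LaurentPolynomial ℤ :=
  ∑ᶠ p : ℤ × ℤ, trinomialCoeff N p.1 p.2 * g p.1 p.2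

theorem trinomialSum_support (N : ℤ) (g : ℤ × ℤ → LaurentPolynomial ℤ) :
    Function.HasFiniteSupport fun p : ℤ × ℤ => trinomialCoeff N p.1 p.2 * g p := by
  refine (Icc (0 : ℤ) N ×ˢ Icc (0 : ℤ) N).finite_toSet.subset fun p hp => ?_
  by_contra h
  refine hp ?_
  dsimp only
  rw [trinomialCoeff_eq_zero (by rwa [Finset.mem_coe, Finset.mem_product] at h), zero_mul]

theorem trinomialSum_eq_sum (N : ℤ) (g : ℤ → ℤ → LaurentPolynomial ℤ) :
    trinomialSum N g =
      ∑ p ∈ Icc (0 : ℤ) N ×ˢ Icc (0 : ℤ) N, trinomialCoeff N p.1 p.2 * g p.1 p.2 := by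
  refine finsum_eq_sum_of_support_subset _ fun p hp => ?_
  by_contra h
  refine hp ?_
  dsimp only
  rw [trinomialCoeff_eq_zero (by rwa [Finset.mem_coe, Finset.mem_product] at h), zero_mul]

theorem trinomialSum_add (N : ℤ) (g h : ℤ → ℤ → LaurentPolynomial ℤ) :
    trinomialSum N (fun m n => g m n + h m n) = trinomialSum N g + trinomialSum N h := by
  simp only [trinomialSum_eq_sum, mul_add, Finset.sum_add_distrib]

theorem trinomialSum_mul_left (N : ℤ) (c : LaurentPolynomial ℤ)
    (g : ℤ → ℤ → LaurentPolynomial ℤ) :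
    trinomialSum N (fun m n => c * g m n) = c * trinomialSum N g := by
  simp only [trinomialSum_eq_sum, Finset.mul_sum, mul_left_comm]

theorem trinomialSum_shift (N a b : ℤ) (g : ℤ → ℤ → LaurentPolynomial ℤ) :
    ∑ᶠ p : ℤ × ℤ, trinomialCoeff N (p.1 - a) (p.2 - b) * g p.1 p.2
      = trinomialSum N fun m n => g (m + a) (n + b) := by
  rw [← finsum_comp_equiv ((Equiv.addRight a).prodCongr (Equiv.addRight b))]
  simp [trinomialSum]

theorem trinomialSum_shift_support (N a b : ℤ) (g : ℤ × ℤ → LaurentPolynomial ℤ) :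
    Function.HasFiniteSupport
      fun p : ℤ × ℤ => trinomialCoeff N (p.1 - a) (p.2 - b) * g p := by
  have h := trinomialSum_support N fun p => g (p.1 + a, p.2 + b)
  have h' := h.preimage (f := fun p : ℤ × ℤ => (p.1 - a, p.2 - b))
    (fun p _ p' _ hpp => by simpa [Prod.ext_iff] using hpp)
  refine h'.subset fun p hp => ?_
  simpa using hp

theorem trinomialSum_succ {N : ℤ} (hN : 0 ≤ N) (g : ℤ → ℤ → LaurentPolynomial ℤ) :
    trinomialSum (N + 1) g = trinomialSum N fun m n =>
      g m n + T (N + 1) * g m (n + 1) + T (N + 1 + (n + 1)) * g (m + 1) (n + 1) := by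
  rw [trinomialSum_add, trinomialSum_add]
  have h₁ := trinomialSum_shift N 0 1 fun m n => T (N + 1) * g m n
  have h₂ := trinomialSum_shift N 1 1 fun m n => T (N + 1 + n) * g m n
  simp only [add_zero] at h₁ h₂
  rw [← h₁, ← h₂, trinomialSum, trinomialSum, ← finsum_add_distrib, ← finsum_add_distrib]
  · refine finsum_congr fun p => ?_
    rw [trinomialCoeff_succ hN, sub_zero]
    ring
  · exact (trinomialSum_support N fun p => g p.1 p.2).fun_add
      (trinomialSum_shift_support N 0 1 fun p => T (N + 1) * g p.1 p.2)
  · exact trinomialSum_shift_support N 1 1 fun p => T (N + 1 + p.2) * g p.1 p.2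
  · exact trinomialSum_support N fun p => g p.1 p.2
  · exact trinomialSum_shift_support N 0 1 fun p => T (N + 1) * g p.1 p.2

theorem trinomialSum_one_sub (N : ℤ) (g : ℤ → ℤ → LaurentPolynomial ℤ) :
    trinomialSum N (fun m n => (1 - T (n - m)) * g m n)
      = trinomialSum N fun m n => (T (n + 1) - T (N + 1)) * g m (n + 1) := by
  have h := trinomialSum_shift N 0 1 fun m n => (T n - T (N + 1)) * g m n
  simp only [add_zero] at h
  rw [← h, trinomialSum]
  refine finsum_congr fun p => ?_
  rw [sub_zero]
  linear_combination g p.1 p.2 * one_sub_mul_trinomialCoeff N p.1 p.2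

/-- The `q`-Hermite recurrence for `[k choose ⌊(k-a)/2⌋]_q`. -/
theorem qbin_half_recurrence {k : ℤ} (hk : 0 ≤ k) (a : ℤ) :
    qbin k ((k - (a - 1)) / 2) + qbin k ((k - (a + 1)) / 2)
      = qbin (k + 1) ((k + 1 - a) / 2) + (1 - T k) * qbin (k - 1) ((k - 1 - a) / 2) := by
  rw [show (k - (a - 1)) / 2 = (k + 1 - a) / 2 by congr 1; ring,
    show (k - (a + 1)) / 2 = (k + 1 - a) / 2 - 1 by omega,
    show (k - 1 - a) / 2 = (k + 1 - a) / 2 - 1 by omega, qbin_pascal hk]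
  linear_combination qbin_absorb k ((k + 1 - a) / 2)

theorem qbin_odd_recurrence {N : ℤ} (hN : 0 ≤ N) (a : ℤ) :
    T (tri a) * qbin (2 * (N + 1) + 1) (N + 1 - a)
      = (1 + T (2 * (N + 1))) * (T (tri a) * qbin (2 * N + 1) (N - a))
        + T (N + 1) * (T (tri (a - 1)) * qbin (2 * N + 1) (N - (a - 1))
          + T (tri (a + 1)) * qbin (2 * N + 1) (N - (a + 1))) := by
  rw [show 2 * (N + 1) + 1 = 2 * N + 1 + 1 + 1 by ring,
    qbin_pascal (by omega : 0 ≤ 2 * N + 1 + 1), qbin_pascal' (by omega : 0 ≤ 2 * N + 1) (N + 1 - a),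
    qbin_pascal' (by omega : 0 ≤ 2 * N + 1) (N + 1 - a - 1),
    show N + 1 - a - 1 = N - a by ring, show N - (a - 1) = N + 1 - a by ring,
    show N - a - 1 = N - (a + 1) by ring]
  have t₁ := tri_succ (a - 1)
  have t₂ := tri_succ a
  rw [sub_add_cancel] at t₁
  have e₁ : (T (tri a) : LaurentPolynomial ℤ) * T (2 * N + 1 + 1 - (N - a))
      = T (N + 1) * T (tri (a + 1)) := by
    rw [← T_add, ← T_add]; congr 1; omega
  have e₂ : (T (tri a) : LaurentPolynomial ℤ) * T (N + 1 - a) = T (N + 1) * T (tri (a - 1)) := by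
    rw [← T_add, ← T_add]; congr 1; omega
  have e₃ : (T (N + 1 - a) : LaurentPolynomial ℤ) * T (2 * N + 1 + 1 - (N + 1 - a))
      = T (2 * (N + 1)) := by
    rw [← T_add]; congr 1; omega
  linear_combination qbin (2 * N + 1) (N - (a + 1)) * e₁ + qbin (2 * N + 1) (N + 1 - a) * e₂
    + T (tri a) * qbin (2 * N + 1) (N - a) * e₃

theorem trinomialSum_congr {N : ℤ} {g h : ℤ → ℤ → LaurentPolynomial ℤ}
    (H : ∀ m n, m ≤ n → g m n = h m n) : trinomialSum N g = trinomialSum N h := by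
  refine finsum_congr fun p => ?_
  rcases le_or_gt p.1 p.2 with hp | hp
  · rw [H _ _ hp]
  · rw [trinomialCoeff, qbin_eq_zero (m := p.2) (n := p.1) (Or.inr hp)]
    simp

/-- The positivity-preserving transformation
`∑_{m,n} q^{T(m)+T(n)} [N choose n]_q [n choose m]_q [n-m choose ⌊(n-m-a)/2⌋]_q
  = q^{T(a)} [2N+1 choose N-a]_q`. -/
theorem trinomialSum_qbin_half {N : ℤ} (hN : 0 ≤ N) (a : ℤ) :
    trinomialSum N (fun m n => qbin (n - m) ((n - m - a) / 2))
      = T (tri a) * qbin (2 * N + 1) (N - a) := by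
  induction N, hN using Int.leInduction generalizing a with
  | base =>
    have h00 : tri 0 = 0 := by simp [tri]
    have h0 : trinomialCoeff 0 0 0 = 1 := by
      simp [trinomialCoeff, qbin_zero_right, h00]
    rw [trinomialSum_eq_sum]
    simp only [Finset.Icc_self, Finset.singleton_product_singleton, Finset.sum_singleton, h0,
      one_mul, sub_self, zero_sub, mul_zero, zero_add]
    by_cases ha : a = 0
    · subst ha
      simp [qbin_zero_right, h00]
    by_cases ha' : a = -1
    · subst ha'
      have h1 : qbin 1 1 = 1 := by
        rw [← qbin_symm, sub_self, qbin_zero_right (by norm_num)]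
      simp [qbin_zero_right, tri, h1]
    · rw [qbin_eq_zero (by omega), qbin_eq_zero (by omega), mul_zero]
  | succ N hN ih =>
    rw [trinomialSum_succ hN, qbin_odd_recurrence hN, ← ih, ← ih, ← ih]
    have key := trinomialSum_one_sub N
      (fun m n => T (N + 1) * qbin (n - m - 1) ((n - m - 1 - a) / 2))
    rw [← trinomialSum_add, ← trinomialSum_mul_left, ← trinomialSum_mul_left]
    have split : trinomialSum N (fun m n => T (N + 1) *
          (qbin (n - m) ((n - m - (a - 1)) / 2) + qbin (n - m) ((n - m - (a + 1)) / 2)))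
        = trinomialSum N (fun m n => T (N + 1) * qbin (n - m + 1) ((n - m + 1 - a) / 2))
          + trinomialSum N (fun m n => (1 - T (n - m)) *
            (T (N + 1) * qbin (n - m - 1) ((n - m - 1 - a) / 2))) := by
      rw [← trinomialSum_add]
      refine trinomialSum_congr fun m n hmn => ?_
      rw [qbin_half_recurrence (by omega)]
      ring
    rw [split, key, ← trinomialSum_add, ← trinomialSum_add]
    refine trinomialSum_congr fun m n _ => ?_
    rw [show n + 1 - m - 1 = n - m by ring, show n + 1 - m = n - m + 1 by ring,
      show n + 1 - (m + 1) = n - m by ring, T_add (N + 1) (n + 1),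
      show 2 * (N + 1) = (N + 1) + (N + 1) by ring, T_add (N + 1) (N + 1)]
    ring

/-- The subsemiring of polynomials with nonnegative coefficients. -/
def nonnegPolynomials : Subsemiring (Polynomial ℤ) where
  carrier := {P | ∀ n, 0 ≤ P.coeff n}
  zero_mem' n := by simp
  one_mem' n := by
    rw [Polynomial.coeff_one]
    split_ifs <;> norm_num
  add_mem' hP hQ n := by
    rw [Polynomial.coeff_add]
    exact add_nonneg (hP n) (hQ n)
  mul_mem' hP hQ n := by
    rw [Polynomial.coeff_mul]
    exact Finset.sum_nonneg fun _ _ => mul_nonneg (hP _) (hQ _)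

theorem X_pow_mem_nonnegPolynomials (k : ℕ) : Polynomial.X ^ k ∈ nonnegPolynomials :=
  pow_mem (fun n => by rw [Polynomial.coeff_X]; split_ifs <;> norm_num) k

/-- The subsemiring of Laurent polynomials with nonnegative coefficients. -/
def nonnegLaurent : Subsemiring (LaurentPolynomial ℤ) where
  carrier := {x | ∃ k : ℕ, ∃ P ∈ nonnegPolynomials, P.toLaurent = T k * x}
  zero_mem' := ⟨0, 0, zero_mem _, by simp⟩
  one_mem' := ⟨0, 1, one_mem _, by simp⟩
  add_mem' := by
    rintro x y ⟨k, P, hP, hx⟩ ⟨l, Q, hQ, hy⟩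
    refine ⟨k + l, Polynomial.X ^ l * P + Polynomial.X ^ k * Q,
      add_mem (mul_mem (X_pow_mem_nonnegPolynomials l) hP)
        (mul_mem (X_pow_mem_nonnegPolynomials k) hQ), ?_⟩
    rw [map_add, map_mul, map_mul, Polynomial.toLaurent_X_pow, Polynomial.toLaurent_X_pow, hx, hy,
      Nat.cast_add, T_add]
    ring
  mul_mem' := by
    rintro x y ⟨k, P, hP, hx⟩ ⟨l, Q, hQ, hy⟩
    refine ⟨k + l, P * Q, mul_mem hP hQ, ?_⟩
    rw [map_mul, hx, hy, Nat.cast_add, T_add]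
    ring

theorem T_mem_nonnegLaurent (n : ℤ) : (T n : LaurentPolynomial ℤ) ∈ nonnegLaurent := by
  refine ⟨n.natAbs, Polynomial.X ^ (n.natAbs + n).toNat, X_pow_mem_nonnegPolynomials _, ?_⟩
  rw [Polynomial.toLaurent_X_pow, ← T_add]
  congr 1
  omega

theorem qbin_mem_nonnegLaurent (m n : ℤ) : qbin m n ∈ nonnegLaurent := by
  unfold qbin
  split_ifs
  · exact ⟨0, gb m.toNat n.toNat, gb_coeff_nonneg _ _, by simp⟩
  · exact zero_mem _

theorem trinomialCoeff_mem_nonnegLaurent (N m n : ℤ) : trinomialCoeff N m n ∈ nonnegLaurent :=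
  mul_mem (mul_mem (T_mem_nonnegLaurent _) (qbin_mem_nonnegLaurent _ _))
    (qbin_mem_nonnegLaurent _ _)

theorem isNonneg_of_mem_nonnegLaurent {P : Polynomial ℤ} {n : ℤ}
    (h : T n * P.toLaurent ∈ nonnegLaurent) : IsNonneg P.toLaurent := by
  refine ⟨P, fun j => ?_, rfl⟩
  have h' := mul_mem (T_mem_nonnegLaurent (-n)) h
  rw [← mul_assoc, ← T_add, neg_add_cancel, T_zero, one_mul] at h'
  obtain ⟨k, Q, hQ, hk⟩ := h'
  rw [← Polynomial.toLaurent_X_pow, ← map_mul, Polynomial.toLaurent_inj] at hk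
  have := hQ (j + k)
  rwa [hk, Polynomial.coeff_X_pow_mul] at this

theorem qbin_comp_hasFiniteSupport (N : ℤ) {e : ℤ → ℤ} (he : Function.Injective e)
    (c : ℤ → LaurentPolynomial ℤ) :
    Function.HasFiniteSupport fun j => c j * qbin N (e j) := by
  refine ((Icc (0 : ℤ) N).finite_toSet.preimage he.injOn).subset fun j hj => ?_
  by_contra h
  refine hj ?_
  rw [Set.mem_preimage, Finset.mem_coe, Finset.mem_Icc] at h
  dsimp only
  rw [qbin_eq_zero (by omega), mul_zero]

/-- The generating function of partitions with prescribed hook differences, with parameters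
`α = 2 - β` and `β`. -/
def hookSum (K i N n β : ℤ) : LaurentPolynomial ℤ :=
  ∑ᶠ t : ℤ, (T (t * (2 * K * t + 2 * i - K * β)) * qbin N (n - K * t)
    - T ((K * t - i) * (2 * t - β)) * qbin N (n - K * t + i))

section hookSum

variable {K : ℤ}

theorem hookSum_support_left (hK : 0 < K) (c : ℤ → LaurentPolynomial ℤ) (N n : ℤ) :
    Function.HasFiniteSupport fun t => c t * qbin N (n - K * t) :=
  qbin_comp_hasFiniteSupport N
    (fun a b h => mul_left_cancel₀ hK.ne' (by simpa using h)) c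

theorem hookSum_support_right (hK : 0 < K) (c : ℤ → LaurentPolynomial ℤ) (i N n : ℤ) :
    Function.HasFiniteSupport fun t => c t * qbin N (n - K * t + i) :=
  qbin_comp_hasFiniteSupport N
    (fun a b h => mul_left_cancel₀ hK.ne' (by simpa using h)) c

theorem hookSum_support (hK : 0 < K) (i N n β : ℤ) :
    Function.HasFiniteSupport fun t =>
      T (t * (2 * K * t + 2 * i - K * β)) * qbin N (n - K * t)
        - T ((K * t - i) * (2 * t - β)) * qbin N (n - K * t + i) :=
  (hookSum_support_left hK _ N n).fun_sub (hookSum_support_right hK _ i N n)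

theorem hookSum_succ (hK : 0 < K) (i : ℤ) {N : ℤ} (hN : 0 ≤ N) (n β : ℤ) :
    hookSum K i (N + 1) n β = hookSum K i N (n - 1) β + T n * hookSum K i N n (β + 1) := by
  unfold hookSum
  rw [mul_finsum' _ _ (hookSum_support hK ..), ← finsum_add_distrib (hookSum_support hK ..)]
  · refine finsum_congr fun t => ?_
    rw [qbin_pascal hN, qbin_pascal hN, show n - K * t - 1 = n - 1 - K * t by ring,
      show n - K * t + i - 1 = n - 1 - K * t + i by ring]
    have e₁ : (T (t * (2 * K * t + 2 * i - K * β)) : LaurentPolynomial ℤ) * T (n - K * t)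
        = T n * T (t * (2 * K * t + 2 * i - K * (β + 1))) := by
      rw [← T_add, ← T_add]; congr 1; ring
    have e₂ : (T ((K * t - i) * (2 * t - β)) : LaurentPolynomial ℤ) * T (n - K * t + i)
        = T n * T ((K * t - i) * (2 * t - (β + 1))) := by
      rw [← T_add, ← T_add]; congr 1; ring
    linear_combination qbin N (n - K * t) * e₁ - qbin N (n - K * t + i) * e₂
  · have h := (hookSum_support hK i N n (β + 1)).mul_right fun _ => T n
    exact h

theorem hookSum_succ' (hK : 0 < K) (i : ℤ) {N : ℤ} (hN : 0 ≤ N) (n β : ℤ) :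
    hookSum K i (N + 1) n β
      = hookSum K i N n β + T (N + 1 - n) * hookSum K i N (n - 1) (β - 1) := by
  unfold hookSum
  rw [mul_finsum' _ _ (hookSum_support hK ..), ← finsum_add_distrib (hookSum_support hK ..)]
  · refine finsum_congr fun t => ?_
    rw [qbin_pascal' hN, qbin_pascal' hN, show n - K * t - 1 = n - 1 - K * t by ring,
      show n - K * t + i - 1 = n - 1 - K * t + i by ring]
    have e₁ : (T (t * (2 * K * t + 2 * i - K * β)) : LaurentPolynomial ℤ)
          * T (N + 1 - (n - K * t))
        = T (N + 1 - n) * T (t * (2 * K * t + 2 * i - K * (β - 1))) := by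
      rw [← T_add, ← T_add]; congr 1; ring
    have e₂ : (T ((K * t - i) * (2 * t - β)) : LaurentPolynomial ℤ)
          * T (N + 1 - (n - K * t + i))
        = T (N + 1 - n) * T ((K * t - i) * (2 * t - (β - 1))) := by
      rw [← T_add, ← T_add]; congr 1; ring
    linear_combination qbin N (n - 1 - K * t) * e₁ - qbin N (n - 1 - K * t + i) * e₂
  · have h := (hookSum_support hK i N (n - 1) (β - 1)).mul_right fun _ => T (N + 1 - n)
    exact h

theorem hookSum_zero_eq_zero (hK : 0 < K) {i N n : ℤ} (h : 2 * n - N = -i) :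
    hookSum K i N n 0 = 0 := by
  unfold hookSum
  rw [finsum_sub_distrib (hookSum_support_left hK _ N n) (hookSum_support_right hK _ i N n),
    sub_eq_zero, ← finsum_comp_equiv (Equiv.neg ℤ)]
  refine finsum_congr fun t => ?_
  rw [Equiv.neg_apply, ← qbin_symm N]
  congr 2
  · ring
  · linarith

theorem hookSum_two_eq_zero (hK : 0 < K) {i N n : ℤ} (h : 2 * n - N = K - i) :
    hookSum K i N n 2 = 0 := by
  unfold hookSum
  rw [finsum_sub_distrib (hookSum_support_left hK _ N n) (hookSum_support_right hK _ i N n),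
    sub_eq_zero, ← finsum_comp_equiv (Equiv.subLeft (1 : ℤ))]
  refine finsum_congr fun t => ?_
  rw [Equiv.subLeft_apply, ← qbin_symm N]
  congr 2
  · ring
  · linarith

theorem hookSum_mem_nonnegLaurent (hK : 2 < K) {i : ℤ} (hi : 0 < i) (hiK : i < K) {N : ℤ}
    (hN : 0 ≤ N) (n β : ℤ) (hβ : 0 ≤ β) (hβ' : β ≤ 2) (h₁ : β - i ≤ 2 * n - N)
    (h₂ : 2 * n - N ≤ K - i - 2 + β) : hookSum K i N n β ∈ nonnegLaurent := by
  have hK0 : 0 < K := by omega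
  induction N, hN using Int.leInduction generalizing n β with
  | base =>
    refine finsum_induction (· ∈ nonnegLaurent) (zero_mem _) (fun _ _ => add_mem) fun t => ?_
    have hne : n - K * t + i ≠ 0 := by
      intro h
      rcases le_or_gt t 0 with ht | ht
      · have : K * t ≤ 0 := mul_nonpos_of_nonneg_of_nonpos hK0.le ht
        omega
      · have : K * 1 ≤ K * t := mul_le_mul_of_nonneg_left (by omega) hK0.le
        omega
    rw [qbin_zero_left_ne hne, mul_zero, sub_zero]
    exact mul_mem (T_mem_nonnegLaurent _) (qbin_mem_nonnegLaurent _ _)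
  | succ N hN ih =>
    have step (hlo : β - i < 2 * n - (N + 1)) (hb : β ≤ 1) :
        hookSum K i (N + 1) n β ∈ nonnegLaurent := by
      rw [hookSum_succ hK0 i hN]
      exact add_mem (ih _ _ (by omega) (by omega) (by omega) (by omega))
        (mul_mem (T_mem_nonnegLaurent _) (ih _ _ (by omega) (by omega) (by omega) (by omega)))
    have step' (hhi : 2 * n - (N + 1) < K - i - 2 + β) (hb : 1 ≤ β) :
        hookSum K i (N + 1) n β ∈ nonnegLaurent := by
      rw [hookSum_succ' hK0 i hN]
      exact add_mem (ih _ _ (by omega) (by omega) (by omega) (by omega))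
        (mul_mem (T_mem_nonnegLaurent _) (ih _ _ (by omega) (by omega) (by omega) (by omega)))
    obtain rfl | rfl | rfl : β = 0 ∨ β = 1 ∨ β = 2 := by omega
    · rcases eq_or_lt_of_le h₁ with h | h
      · rw [hookSum_zero_eq_zero hK0 (by omega)]
        exact zero_mem _
      · exact step h (by norm_num)
    · rcases eq_or_lt_of_le h₁ with h | h
      · exact step' (by omega) le_rfl
      · exact step h le_rfl
    · rcases eq_or_lt_of_le h₂ with h | h
      · rw [hookSum_two_eq_zero hK0 (by omega)]
        exact zero_mem _
      · exact step' h (by norm_num)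

end hookSum

theorem finsum_int_eq_even_add_odd {M : Type*} [AddCommMonoid M] {f : ℤ → M}
    (hf : Function.HasFiniteSupport f) :
    ∑ᶠ j, f j = ∑ᶠ t, (f (2 * t) + f (1 - 2 * t)) := by
  have i₁ : Function.Injective fun t : ℤ => 2 * t := fun a b h => by
    dsimp only at h; omega
  have i₂ : Function.Injective fun t : ℤ => 1 - 2 * t := fun a b h => by
    dsimp only at h; omega
  have hu : Set.range (fun t : ℤ => 2 * t) ∪ Set.range (fun t : ℤ => 1 - 2 * t) = Set.univ := by
    refine Set.eq_univ_of_forall fun j => ?_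
    rcases Int.even_or_odd' j with ⟨c, rfl | rfl⟩
    · exact Or.inl ⟨c, rfl⟩
    · exact Or.inr ⟨-c, by dsimp only; ring⟩
  have hd : Disjoint (Set.range fun t : ℤ => 2 * t) (Set.range fun t : ℤ => 1 - 2 * t) := by
    rw [Set.disjoint_left]
    rintro _ ⟨a, rfl⟩ ⟨b, hb⟩
    dsimp only at hb
    omega
  rw [← finsum_mem_univ, ← hu, finsum_mem_union' hd (hf.inter_of_right _) (hf.inter_of_right _),
    finsum_mem_range i₁, finsum_mem_range i₂, finsum_add_distrib]
  · exact hf.preimage i₁.injOn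
  · exact hf.preimage i₂.injOn

theorem halfSum_support {K : ℤ} (hK : 2 ≤ K) (k s : ℤ) (c : ℤ → LaurentPolynomial ℤ) :
    Function.HasFiniteSupport fun j => c j * qbin k ((k - (s + K * j)) / 2) := by
  refine qbin_comp_hasFiniteSupport k (e := fun j => (k - (s + K * j)) / 2)
    (StrictAnti.injective fun a b hab => ?_) c
  have : K * (a + 1) ≤ K * b := mul_le_mul_of_nonneg_left hab (by omega)
  rw [mul_add, mul_one] at this
  omega

/-- The polynomial analogue of the Andrews–Gordon product sides, with exponent
`j((2ν+1)j + 2s+1)/2` written as a difference of the exponent in `F` and a triangular number. -/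
theorem halfSum_mem_nonnegLaurent {ν s k : ℤ} (hs0 : 0 ≤ s) (hs : s < ν) (hk : 0 ≤ k) :
    ∑ᶠ j : ℤ, ((Int.negOnePow j : ℤ) : LaurentPolynomial ℤ) *
        T ((ν + 1) * (2 * ν + 1) * j ^ 2 + (ν + 1) * (2 * s + 1) * j + tri s
          - tri (s + (2 * ν + 1) * j)) *
        qbin k ((k - (s + (2 * ν + 1) * j)) / 2) ∈ nonnegLaurent := by
  rw [finsum_int_eq_even_add_odd (halfSum_support (by omega) k s _)]
  have h := hookSum_mem_nonnegLaurent (K := 2 * ν + 1) (i := ν + s + 1) (by omega) (by omega)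
    (by omega) hk ((k - s) / 2) 1 (by norm_num) (by norm_num) (by omega) (by omega)
  convert h using 1
  refine finsum_congr fun t => ?_
  rw [Int.negOnePow_two_mul, Int.negOnePow_odd (1 - 2 * t) ⟨-t, by ring⟩]
  have t₀ := two_mul_tri s
  have t₁ := two_mul_tri (s + (2 * ν + 1) * (2 * t))
  have t₂ := two_mul_tri (s + (2 * ν + 1) * (1 - 2 * t))
  have e₁ : (ν + 1) * (2 * ν + 1) * (2 * t) ^ 2 + (ν + 1) * (2 * s + 1) * (2 * t) + tri s
        - tri (s + (2 * ν + 1) * (2 * t))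
      = t * (2 * (2 * ν + 1) * t + 2 * (ν + s + 1) - (2 * ν + 1) * 1) := by
    linarith
  have e₂ : (ν + 1) * (2 * ν + 1) * (1 - 2 * t) ^ 2 + (ν + 1) * (2 * s + 1) * (1 - 2 * t) + tri s
        - tri (s + (2 * ν + 1) * (1 - 2 * t))
      = ((2 * ν + 1) * t - (ν + s + 1)) * (2 * t - 1) := by
    linarith
  have b₁ : (k - (s + (2 * ν + 1) * (2 * t))) / 2 = (k - s) / 2 - (2 * ν + 1) * t := by
    rw [show (2 * ν + 1) * (2 * t) = 2 * ((2 * ν + 1) * t) by ring]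
    omega
  have b₂ : k - (k - (s + (2 * ν + 1) * (1 - 2 * t))) / 2
      = (k - s) / 2 - (2 * ν + 1) * t + (ν + s + 1) := by
    rw [show (2 * ν + 1) * (1 - 2 * t) = 2 * ν + 1 - 2 * ((2 * ν + 1) * t) by ring]
    omega
  rw [e₁, e₂, b₁, ← qbin_symm k ((k - (s + (2 * ν + 1) * (1 - 2 * t))) / 2), b₂]
  push_cast
  ring

/-- For `L ∈ ℕ`, `ν ≥ 1` and `0 ≤ s ≤ ν - 1`, the polynomial
`F(L,ν,s,q) = ∑_{j ∈ ℤ} (-1)^j q^{(ν+1)(2ν+1)j² + (ν+1)(2s+1)j}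
  [2L+1 choose L-s-(2ν+1)j]_q` has nonnegative coefficients. -/
theorem F_nonneg (L ν s : ℕ) (hν : 0 < ν) (hs : s < ν) :
    IsNonneg (∑ᶠ j : ℤ,
      ((Int.negOnePow j : ℤ) : LaurentPolynomial ℤ) *
        T (((ν : ℤ) + 1) * (2 * ν + 1) * j ^ 2 + ((ν : ℤ) + 1) * (2 * s + 1) * j) *
        qbin (2 * L + 1) ((L : ℤ) - s - (2 * ν + 1) * j)) := by
  have hF : ∃ P : Polynomial ℤ, P.toLaurent = ∑ᶠ j : ℤ,
      ((Int.negOnePow j : ℤ) : LaurentPolynomial ℤ) *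
        T (((ν : ℤ) + 1) * (2 * ν + 1) * j ^ 2 + ((ν : ℤ) + 1) * (2 * s + 1) * j) *
        qbin (2 * L + 1) ((L : ℤ) - s - (2 * ν + 1) * j) := by
    refine finsum_induction
      (· ∈ (Polynomial.toLaurent : Polynomial ℤ →+* LaurentPolynomial ℤ).range)
      (zero_mem _) (fun _ _ => add_mem) fun j => mul_mem (mul_mem (intCast_mem _ _) ?_) ?_
    · have hE : 0 ≤ ((ν : ℤ) + 1) * (2 * ν + 1) * j ^ 2 + ((ν : ℤ) + 1) * (2 * s + 1) * j := by
        rw [show ((ν : ℤ) + 1) * (2 * ν + 1) * j ^ 2 + ((ν : ℤ) + 1) * (2 * s + 1) * j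
          = (ν + 1) * (j * ((2 * ν + 1) * j + (2 * s + 1))) by ring]
        refine mul_nonneg (by positivity) ?_
        rcases le_or_gt 0 j with hj | hj
        · positivity
        · refine mul_nonneg_of_nonpos_of_nonpos hj.le ?_
          have : (2 * (ν : ℤ) + 1) * j ≤ (2 * ν + 1) * (-1) :=
            mul_le_mul_of_nonneg_left (by omega) (by positivity)
          omega
      obtain ⟨E, hE⟩ := Int.eq_ofNat_of_zero_le hE
      exact ⟨Polynomial.X ^ E, by rw [hE, Polynomial.toLaurent_X_pow]⟩
    · unfold qbin
      split_ifs
      · exact ⟨_, rfl⟩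
      · exact zero_mem _
  obtain ⟨P, hP⟩ := hF
  rw [← hP]
  refine isNonneg_of_mem_nonnegLaurent (n := tri s) ?_
  have hinj : Function.Injective fun j : ℤ => (L : ℤ) - s - (2 * ν + 1) * j := fun a b h =>
    mul_left_cancel₀ (by omega : (2 * (ν : ℤ) + 1) ≠ 0) (by simpa using h)
  rw [hP, mul_finsum' _ _ (qbin_comp_hasFiniteSupport _ hinj _)]
  have hterm (j : ℤ) : T (tri s) * (((Int.negOnePow j : ℤ) : LaurentPolynomial ℤ) *
        T (((ν : ℤ) + 1) * (2 * ν + 1) * j ^ 2 + ((ν : ℤ) + 1) * (2 * s + 1) * j) *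
        qbin (2 * L + 1) ((L : ℤ) - s - (2 * ν + 1) * j))
      = ∑ p ∈ Icc (0 : ℤ) L ×ˢ Icc (0 : ℤ) L, trinomialCoeff L p.1 p.2 *
        (((Int.negOnePow j : ℤ) : LaurentPolynomial ℤ) *
          T (((ν : ℤ) + 1) * (2 * ν + 1) * j ^ 2 + ((ν : ℤ) + 1) * (2 * s + 1) * j + tri s
            - tri (s + (2 * ν + 1) * j)) *
          qbin (p.2 - p.1) ((p.2 - p.1 - (s + (2 * ν + 1) * j)) / 2)) := by
    have h := trinomialSum_qbin_half (Int.natCast_nonneg L) (s + (2 * ν + 1) * j)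
    rw [← trinomialSum_eq_sum (L : ℤ) fun m n =>
      ((Int.negOnePow j : ℤ) : LaurentPolynomial ℤ) *
        T (((ν : ℤ) + 1) * (2 * ν + 1) * j ^ 2 + ((ν : ℤ) + 1) * (2 * s + 1) * j + tri s
          - tri (s + (2 * ν + 1) * j)) *
        qbin (n - m) ((n - m - (s + (2 * ν + 1) * j)) / 2), trinomialSum_mul_left, h,
      show (L : ℤ) - (s + (2 * ν + 1) * j) = L - s - (2 * ν + 1) * j by ring]
    have e : (T (((ν : ℤ) + 1) * (2 * ν + 1) * j ^ 2 + ((ν : ℤ) + 1) * (2 * s + 1) * j + tri s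
          - tri (s + (2 * ν + 1) * j)) : LaurentPolynomial ℤ) * T (tri (s + (2 * ν + 1) * j))
        = T (tri s) *
          T (((ν : ℤ) + 1) * (2 * ν + 1) * j ^ 2 + ((ν : ℤ) + 1) * (2 * s + 1) * j) := by
      rw [← T_add, ← T_add]; congr 1; ring
    linear_combination -((Int.negOnePow j : ℤ) : LaurentPolynomial ℤ) *
      qbin (2 * L + 1) ((L : ℤ) - s - (2 * ν + 1) * j) * e
  rw [finsum_congr hterm]
  have hsupp (p : ℤ × ℤ) := halfSum_support (by omega : 2 ≤ 2 * (ν : ℤ) + 1) (p.2 - p.1) s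
    fun j => ((Int.negOnePow j : ℤ) : LaurentPolynomial ℤ) *
      T (((ν : ℤ) + 1) * (2 * ν + 1) * j ^ 2 + ((ν : ℤ) + 1) * (2 * s + 1) * j + tri s
        - tri (s + (2 * ν + 1) * j))
  rw [finsum_sum_comm]
  swap
  · exact fun p _ => (hsupp p).mul_right fun _ => trinomialCoeff L p.1 p.2
  refine sum_mem fun p _ => ?_
  rw [← mul_finsum' _ _ (hsupp p)]
  rcases le_or_gt p.1 p.2 with hp | hp
  · exact mul_mem (trinomialCoeff_mem_nonnegLaurent _ _ _)
      (halfSum_mem_nonnegLaurent (by omega) (by omega) (by omega))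
  · rw [trinomialCoeff, qbin_eq_zero (m := p.2) (n := p.1) (Or.inr hp), mul_zero, zero_mul]
    exact zero_mem _
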